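/- (Regime where the Butucea–Ingster rate is suboptimal.) Fix η ∈ (0,1) and a constant α > 0. There exist sufficiently small constants c₁, c₂ > 0 and constants c, C > 0 such that for all positive integers d₁, d₂ and integers 1 ≤ s₁ ≤ d₁, 1 ≤ s₂ ≤ d₂ satisfying s₁² > d₁·s₂·log(d₂), s₁ ≤ c₁·d₁, s₂ ≤ c₂·d₂, d₁/s₁ ≥ e·log(d₂/s₂), and d₂ ≥ s₂^{2+α}, the minimax separation rate satisfies c·(d₁/s₁²)·log(d₂) ≤ (μ*)² ≤ C·(d₁/s₁²)·log(d₂). -/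

import Mathlib

open MeasureTheory ProbabilityTheory

noncomputable def Pmeas (d₁ d₂ : ℕ) (X : Fin d₁ → Fin d₂ → ℝ) :
    Measure (Fin d₁ → Fin d₂ → ℝ) :=
  Measure.pi fun i => Measure.pi fun j => gaussianReal (X i j) 1

def Theta (d₁ d₂ s₁ s₂ : ℕ) (μ : ℝ) : Set (Fin d₁ → Fin d₂ → ℝ) :=
  {X | ∃ (S₁ : Finset (Fin d₁)) (S₂ : Finset (Fin d₂)),
    S₁.card = s₁ ∧ S₂.card = s₂ ∧
    (∀ i j, i ∈ S₁ → j ∈ S₂ → μ ≤ X i j) ∧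
    (∀ i j, ¬(i ∈ S₁ ∧ j ∈ S₂) → X i j = 0)}

noncomputable def risk (d₁ d₂ s₁ s₂ : ℕ) (μ : ℝ)
    (Δ : (Fin d₁ → Fin d₂ → ℝ) → Bool) : ℝ :=
  (Pmeas d₁ d₂ 0 {y | Δ y = true}).toReal +
    ⨆ X ∈ Theta d₁ d₂ s₁ s₂ μ, (Pmeas d₁ d₂ X {y | Δ y = false}).toReal

noncomputable def muStar (η : ℝ) (d₁ d₂ s₁ s₂ : ℕ) : ℝ :=
  sInf {μ : ℝ | 0 < μ ∧ ∃ Δ : (Fin d₁ → Fin d₂ → ℝ) → Bool,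
    Measurable Δ ∧ risk d₁ d₂ s₁ s₂ μ Δ < η}


lemma lintegral_pi_prod {ι : Type*} [Fintype ι] {E : ι → Type*} [∀ i, MeasurableSpace (E i)]
    (ν : ∀ i, Measure (E i)) [∀ i, IsProbabilityMeasure (ν i)] (f : ∀ i, E i → ENNReal)
    (hf : ∀ i, Measurable (f i)) :
    ∫⁻ x, ∏ i, f i (x i) ∂(Measure.pi ν) = ∏ i, ∫⁻ x, f i x ∂(ν i) := by
  rw [lintegral_prod_eq_prod_lintegral_of_indepFun (μ := Measure.pi ν) Finset.univ
    (fun i x => f i (x i)) (iIndepFun_pi fun i => (hf i).aemeasurable)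
    (fun i => (hf i).comp (measurable_pi_apply i))]
  refine Finset.prod_congr rfl fun i _ => ?_
  exact (measurePreserving_eval ν i).lintegral_comp (hf i)

lemma pi_withDensity {ι : Type*} [Fintype ι] {E : ι → Type*} [∀ i, MeasurableSpace (E i)]
    (ν : ∀ i, Measure (E i)) [∀ i, IsProbabilityMeasure (ν i)] (f : ∀ i, E i → ENNReal)
    (hf : ∀ i, Measurable (f i)) [∀ i, SigmaFinite ((ν i).withDensity (f i))] :
    Measure.pi (fun i => (ν i).withDensity (f i)) =
      (Measure.pi ν).withDensity fun x => ∏ i, f i (x i) := by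
  refine Measure.pi_eq fun s hs => ?_
  rw [withDensity_apply _ (MeasurableSet.univ_pi hs),
    ← lintegral_indicator (MeasurableSet.univ_pi hs)]
  simp_rw [withDensity_apply _ (hs _), ← lintegral_indicator (hs _)]
  rw [← lintegral_pi_prod ν _ fun i => (hf i).indicator (hs i)]
  refine lintegral_congr fun x => ?_
  by_cases hx : x ∈ Set.univ.pi s
  · rw [Set.indicator_of_mem hx]
    exact Finset.prod_congr rfl fun i _ => by rw [Set.indicator_of_mem (hx i trivial)]
  · rw [Set.indicator_of_notMem hx]
    obtain ⟨i, hi⟩ : ∃ i, x i ∉ s i := by simpa [Set.mem_pi] using hx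
    exact (Finset.prod_eq_zero (Finset.mem_univ i) (Set.indicator_of_notMem hi _)).symm

lemma gaussianReal_one_eq_withDensity (m : ℝ) :
    gaussianReal m 1 = (gaussianReal 0 1).withDensity
      fun y => ENNReal.ofReal (Real.exp (m * y - m * m / 2)) := by
  rw [gaussianReal_of_var_ne_zero _ one_ne_zero, gaussianReal_of_var_ne_zero _ one_ne_zero,
    ← withDensity_mul _ (measurable_gaussianPDF _ _) (by fun_prop)]
  congr 1
  ext y
  simp only [Pi.mul_apply, gaussianPDF, gaussianPDFReal]
  rw [← ENNReal.ofReal_mul (by positivity), mul_assoc _ (Real.exp _), ← Real.exp_add]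
  congr 3
  simp
  ring

/-- Frobenius inner product of two matrices. -/
def frobInner {d₁ d₂ : ℕ} (X Y : Fin d₁ → Fin d₂ → ℝ) : ℝ :=
  ∑ i, ∑ j, X i j * Y i j

instance {d₁ d₂ : ℕ} (X : Fin d₁ → Fin d₂ → ℝ) : IsProbabilityMeasure (Pmeas d₁ d₂ X) := by
  unfold Pmeas; infer_instance

@[fun_prop]
lemma measurable_frobInner {d₁ d₂ : ℕ} (X : Fin d₁ → Fin d₂ → ℝ) :
    Measurable (frobInner X) := by
  unfold frobInner; fun_prop

/-- Likelihood ratio of `Pmeas X` with respect to `Pmeas 0`. -/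
noncomputable def likelihood {d₁ d₂ : ℕ} (X y : Fin d₁ → Fin d₂ → ℝ) : ℝ :=
  Real.exp (frobInner X y - frobInner X X / 2)

lemma likelihood_pos {d₁ d₂ : ℕ} (X y : Fin d₁ → Fin d₂ → ℝ) : 0 < likelihood X y :=
  Real.exp_pos _

@[fun_prop]
lemma measurable_likelihood {d₁ d₂ : ℕ} (X : Fin d₁ → Fin d₂ → ℝ) :
    Measurable (likelihood X) := by
  unfold likelihood; fun_prop

lemma Pmeas_eq_withDensity {d₁ d₂ : ℕ} (X : Fin d₁ → Fin d₂ → ℝ) :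
    Pmeas d₁ d₂ X = (Pmeas d₁ d₂ 0).withDensity fun y => ENNReal.ofReal (likelihood X y) := by
  have h₁ : ∀ i, (Measure.pi fun j => gaussianReal (X i j) 1) =
      (Measure.pi fun _ : Fin d₂ => gaussianReal 0 1).withDensity fun y =>
        ∏ j, ENNReal.ofReal (Real.exp (X i j * y j - X i j * X i j / 2)) := by
    intro i
    have : ∀ j, SigmaFinite ((gaussianReal 0 1).withDensity
        fun y => ENNReal.ofReal (Real.exp (X i j * y - X i j * X i j / 2))) := by
      intro j
      rw [← gaussianReal_one_eq_withDensity]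
      infer_instance
    rw [← pi_withDensity _ (fun j y => ENNReal.ofReal (Real.exp (X i j * y - X i j * X i j / 2)))
      (by fun_prop)]
    simp_rw [← gaussianReal_one_eq_withDensity]
  have : ∀ i, SigmaFinite ((Measure.pi fun _ : Fin d₂ => gaussianReal 0 1).withDensity fun y =>
      ∏ j, ENNReal.ofReal (Real.exp (X i j * y j - X i j * X i j / 2))) := by
    intro i
    rw [← h₁]
    infer_instance
  unfold Pmeas
  simp_rw [h₁]
  rw [pi_withDensity _ _ (by fun_prop)]
  congr 1
  ext y
  simp_rw [← ENNReal.ofReal_prod_of_nonneg (fun _ _ => (Real.exp_pos _).le), ← Real.exp_sum]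
  rw [← ENNReal.ofReal_prod_of_nonneg (fun _ _ => (Real.exp_pos _).le), ← Real.exp_sum]
  simp [likelihood, frobInner, Finset.sum_sub_distrib, Finset.sum_div]

lemma lintegral_likelihood {d₁ d₂ : ℕ} (X : Fin d₁ → Fin d₂ → ℝ) :
    ∫⁻ y, ENNReal.ofReal (likelihood X y) ∂(Pmeas d₁ d₂ 0) = 1 := by
  have h := measure_univ (μ := Pmeas d₁ d₂ X)
  rwa [Pmeas_eq_withDensity, withDensity_apply _ MeasurableSet.univ, setLIntegral_univ] at h

lemma integrable_likelihood {d₁ d₂ : ℕ} (X : Fin d₁ → Fin d₂ → ℝ) :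
    Integrable (likelihood X) (Pmeas d₁ d₂ 0) :=
  (lintegral_ofReal_ne_top_iff_integrable (measurable_likelihood X).aestronglyMeasurable
    (ae_of_all _ fun y => (likelihood_pos X y).le)).1 (by simp [lintegral_likelihood])

lemma integral_likelihood {d₁ d₂ : ℕ} (X : Fin d₁ → Fin d₂ → ℝ) :
    ∫ y, likelihood X y ∂(Pmeas d₁ d₂ 0) = 1 := by
  rw [integral_eq_lintegral_of_nonneg_ae (ae_of_all _ fun y => (likelihood_pos X y).le)
    (measurable_likelihood X).aestronglyMeasurable, lintegral_likelihood, ENNReal.toReal_one]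

lemma exp_frobInner_mul_likelihood {d₁ d₂ : ℕ} (W X y : Fin d₁ → Fin d₂ → ℝ) :
    Real.exp (frobInner W y) * likelihood X y =
      Real.exp (frobInner W X + frobInner W W / 2) * likelihood (W + X) y := by
  unfold likelihood
  rw [← Real.exp_add, ← Real.exp_add]
  congr 1
  have h₁ : frobInner (W + X) y = frobInner W y + frobInner X y := by
    simp [frobInner, add_mul, Finset.sum_add_distrib]
  have h₂ : frobInner (W + X) (W + X) = frobInner W W + 2 * frobInner W X + frobInner X X := by
    simp only [frobInner, Finset.mul_sum, ← Finset.sum_add_distrib]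
    refine Finset.sum_congr rfl fun i _ => Finset.sum_congr rfl fun j _ => ?_
    simp only [Pi.add_apply]
    ring
  rw [h₁, h₂]
  ring

lemma likelihood_mul_likelihood {d₁ d₂ : ℕ} (W X y : Fin d₁ → Fin d₂ → ℝ) :
    likelihood W y * likelihood X y = Real.exp (frobInner W X) * likelihood (W + X) y := by
  have h := exp_frobInner_mul_likelihood W X y
  have : likelihood W y = Real.exp (frobInner W y) * Real.exp (-(frobInner W W / 2)) := by
    rw [likelihood, ← Real.exp_add, sub_eq_add_neg]
  rw [this, mul_right_comm, h, mul_right_comm, ← Real.exp_add]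
  congr 2
  ring

lemma Pmeas_real_eq_setIntegral {d₁ d₂ : ℕ} (X : Fin d₁ → Fin d₂ → ℝ)
    {A : Set (Fin d₁ → Fin d₂ → ℝ)} (hA : MeasurableSet A) :
    (Pmeas d₁ d₂ X).real A = ∫ y in A, likelihood X y ∂(Pmeas d₁ d₂ 0) := by
  rw [integral_eq_lintegral_of_nonneg_ae (ae_of_all _ fun y => (likelihood_pos X y).le)
    (measurable_likelihood X).aestronglyMeasurable, measureReal_def, Pmeas_eq_withDensity,
    withDensity_apply _ hA]

/-- Chernoff bound for a linear statistic of a Gaussian matrix. -/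
lemma Pmeas_real_le_frobInner_le {d₁ d₂ : ℕ} (W X : Fin d₁ → Fin d₂ → ℝ) (r : ℝ) :
    (Pmeas d₁ d₂ X).real {y | r ≤ frobInner W y} ≤
      Real.exp (frobInner W X + frobInner W W / 2 - r) := by
  have hA : MeasurableSet {y : Fin d₁ → Fin d₂ → ℝ | r ≤ frobInner W y} :=
    measurableSet_le measurable_const (measurable_frobInner W)
  have hint := (integrable_likelihood (W + X)).const_mul
    (Real.exp (frobInner W X + frobInner W W / 2 - r))
  rw [Pmeas_real_eq_setIntegral X hA]
  calc ∫ y in {y | r ≤ frobInner W y}, likelihood X y ∂(Pmeas d₁ d₂ 0)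
      ≤ ∫ y in {y | r ≤ frobInner W y},
          Real.exp (frobInner W X + frobInner W W / 2 - r) * likelihood (W + X) y
            ∂(Pmeas d₁ d₂ 0) := by
        refine setIntegral_mono_on (integrable_likelihood X).integrableOn hint.integrableOn hA
          fun y hy => ?_
        have h := exp_frobInner_mul_likelihood W X y
        rw [Real.exp_sub, div_mul_eq_mul_div, ← h, le_div_iff₀ (Real.exp_pos r), mul_comm]
        exact mul_le_mul_of_nonneg_right (Real.exp_le_exp.2 hy) (likelihood_pos X y).le
    _ ≤ ∫ y, Real.exp (frobInner W X + frobInner W W / 2 - r) * likelihood (W + X) y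
            ∂(Pmeas d₁ d₂ 0) :=
        setIntegral_le_integral hint (ae_of_all _ fun y =>
          (mul_pos (Real.exp_pos _) (likelihood_pos _ y)).le)
    _ = _ := by rw [integral_const_mul, integral_likelihood, mul_one]

/-- Second-moment bound: a finite mixture of Gaussian matrix laws is close to the null law as soon
as its likelihood ratio has second moment close to one. -/
lemma sub_avg_Pmeas_real_le {d₁ d₂ : ℕ} {ι : Type*} [Fintype ι] [Nonempty ι]
    (X : ι → Fin d₁ → Fin d₂ → ℝ) {A : Set (Fin d₁ → Fin d₂ → ℝ)} (hA : MeasurableSet A)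
    {δ : ℝ} (hδ : 0 < δ)
    (hX : ∑ a, ∑ b, Real.exp (frobInner (X a) (X b)) ≤ (1 + δ ^ 2) * (Fintype.card ι : ℝ) ^ 2) :
    (Pmeas d₁ d₂ 0).real A - (∑ a, (Pmeas d₁ d₂ (X a)).real A) / Fintype.card ι ≤ δ := by
  set P := Pmeas d₁ d₂ 0
  set N : ℝ := (Fintype.card ι : ℝ)
  have hN : 0 < N := Nat.cast_pos.2 Fintype.card_pos
  let L : (Fin d₁ → Fin d₂ → ℝ) → ℝ := fun y => (∑ a, likelihood (X a) y) / N
  have hLint : Integrable L P :=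
    (integrable_finsetSum _ fun a _ => integrable_likelihood (X a)).div_const _
  have hLavg : ∫ y, L y ∂P = 1 := by
    simp only [L, P]
    rw [integral_div, integral_finsetSum _ fun a _ => integrable_likelihood (X a)]
    simp [integral_likelihood, N]
  have hsq : ∀ y, L y ^ 2 = (∑ a, ∑ b, Real.exp (frobInner (X a) (X b)) *
      likelihood (X a + X b) y) / N ^ 2 := by
    intro y
    simp only [L, div_pow]
    rw [sq (∑ a, _), Finset.sum_mul_sum]
    simp_rw [likelihood_mul_likelihood]
  have hLL : Integrable (fun y => L y ^ 2) P := by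
    simp_rw [hsq]
    exact (integrable_finsetSum _ fun a _ => integrable_finsetSum _ fun b _ =>
      (integrable_likelihood _).const_mul _).div_const _
  have hLLavg : ∫ y, L y ^ 2 ∂P ≤ 1 + δ ^ 2 := by
    simp_rw [hsq]
    rw [integral_div, integral_finsetSum _ fun a _ => integrable_finsetSum _ fun b _ =>
      (integrable_likelihood _).const_mul _]
    simp_rw [integral_finsetSum _ fun b _ => (integrable_likelihood _).const_mul _,
      integral_const_mul]
    simp only [integral_likelihood, mul_one]
    exact (div_le_iff₀ (by positivity)).2 hX
  have hlin : Integrable (fun y => 1 - 2 * L y) P :=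
    (integrable_const 1).sub (hLint.const_mul 2)
  have hexp : (fun y => (1 - L y) ^ 2) = fun y => 1 - 2 * L y + L y ^ 2 := by ext y; ring
  have hdev : Integrable (fun y => (1 - L y) ^ 2) P := by
    rw [hexp]
    exact hlin.add hLL
  have hdevavg : ∫ y, (1 - L y) ^ 2 ∂P ≤ δ ^ 2 := by
    rw [hexp, integral_add hlin hLL,
      integral_sub (integrable_const 1) (hLint.const_mul 2), integral_const_mul, hLavg]
    simp
    linarith
  have hmean : (∑ a, (Pmeas d₁ d₂ (X a)).real A) / N = ∫ y in A, L y ∂P := by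
    simp_rw [Pmeas_real_eq_setIntegral _ hA]
    simp only [L]
    rw [integral_div, integral_finsetSum _ fun a _ => (integrable_likelihood (X a)).integrableOn]
  have hdiff : P.real A - (∑ a, (Pmeas d₁ d₂ (X a)).real A) / N = ∫ y in A, (1 - L y) ∂P := by
    rw [hmean, integral_sub (integrable_const _) hLint.integrableOn]
    simp
  rw [hdiff]
  have hdom : Integrable (fun y => ((1 - L y) ^ 2 / δ + δ) / 2) P :=
    ((hdev.div_const δ).add (integrable_const δ)).div_const 2
  calc ∫ y in A, (1 - L y) ∂P
      ≤ ∫ y in A, ((1 - L y) ^ 2 / δ + δ) / 2 ∂P := by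
        refine setIntegral_mono ((integrable_const 1).sub hLint).integrableOn hdom.integrableOn
          fun y => ?_
        have h : 0 ≤ (1 - L y - δ) ^ 2 / δ := by positivity
        have h' : (1 - L y - δ) ^ 2 / δ = (1 - L y) ^ 2 / δ + δ - 2 * (1 - L y) := by
          field_simp
          ring
        change 1 - L y ≤ ((1 - L y) ^ 2 / δ + δ) / 2
        linarith
    _ ≤ ∫ y, ((1 - L y) ^ 2 / δ + δ) / 2 ∂P :=
        setIntegral_le_integral hdom (ae_of_all _ fun y => by positivity)
    _ = ((∫ y, (1 - L y) ^ 2 ∂P) / δ + δ) / 2 := by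
        rw [integral_div, integral_add (hdev.div_const δ) (integrable_const δ), integral_div]
        simp
    _ ≤ (δ ^ 2 / δ + δ) / 2 := by gcongr
    _ = δ := by field_simp; ring

section Selections

/-- The subset of `Fin d` that takes one element, prescribed by `f`, in each of `s` disjoint blocks
of length `m`. -/
def selection {s m d : ℕ} (h : s * m ≤ d) (f : Fin s → Fin m) : Finset (Fin d) :=
  Finset.univ.image fun k => Fin.castLE h (finProdFinEquiv (k, f k))

/-- Number of coordinates where two functions agree. -/
def agreement {s m : ℕ} (f g : Fin s → Fin m) : ℕ :=
  (Finset.univ.filter fun k => f k = g k).card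

lemma agreement_le {s m : ℕ} (f g : Fin s → Fin m) : agreement f g ≤ s :=
  (Finset.card_filter_le _ _).trans (by simp)

lemma selection_injective {s m d : ℕ} (h : s * m ≤ d) (f : Fin s → Fin m) :
    Function.Injective fun k => Fin.castLE h (finProdFinEquiv (k, f k)) := by
  intro k l hkl
  have := finProdFinEquiv.injective (Fin.castLE_injective h hkl)
  exact (Prod.mk.inj this).1

lemma card_selection {s m d : ℕ} (h : s * m ≤ d) (f : Fin s → Fin m) :
    (selection h f).card = s := by
  rw [selection, Finset.card_image_of_injective _ (selection_injective h f)]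
  simp

lemma card_selection_inter {s m d : ℕ} (h : s * m ≤ d) (f g : Fin s → Fin m) :
    (selection h f ∩ selection h g).card = agreement f g := by
  have : selection h f ∩ selection h g = (Finset.univ.filter fun k => f k = g k).image
      fun k => Fin.castLE h (finProdFinEquiv (k, f k)) := by
    ext x
    simp only [selection, Finset.mem_inter, Finset.mem_image, Finset.mem_univ, true_and,
      Finset.mem_filter]
    constructor
    · rintro ⟨⟨k, rfl⟩, l, hl⟩
      have := finProdFinEquiv.injective (Fin.castLE_injective h hl)
      obtain ⟨rfl, h₂⟩ := Prod.mk.inj this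
      exact ⟨l, h₂.symm, rfl⟩
    · rintro ⟨k, hk, rfl⟩
      exact ⟨⟨k, rfl⟩, k, by rw [hk]⟩
  rw [this, Finset.card_image_of_injective _ (selection_injective h f), agreement]

lemma sum_exp_agreement {s m : ℕ} (f : Fin s → Fin m) (t : ℝ) :
    ∑ g : Fin s → Fin m, Real.exp (t * agreement f g) = (m + (Real.exp t - 1)) ^ s := by
  have h₁ : ∀ g : Fin s → Fin m, Real.exp (t * agreement f g) =
      ∏ k, if f k = g k then Real.exp t else 1 := by
    intro g
    rw [Finset.prod_ite, Finset.prod_const, Finset.prod_const_one, mul_one, ← Real.exp_nat_mul,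
      agreement, mul_comm]
  have h₂ : ∀ k, ∑ a : Fin m, (if f k = a then Real.exp t else 1) = m + (Real.exp t - 1) := by
    intro k
    have : ∀ a : Fin m, (if f k = a then Real.exp t else 1) =
        1 + if f k = a then Real.exp t - 1 else 0 := by
      intro a
      split_ifs <;> ring
    simp_rw [this]
    rw [Finset.sum_add_distrib, Finset.sum_ite_eq]
    simp
  simp_rw [h₁]
  rw [← Fintype.piFinset_univ,
    ← Finset.prod_univ_sum (fun _ => Finset.univ) fun k a => if f k = a then Real.exp t else 1]
  simp_rw [h₂]
  simp

lemma sum_sum_exp_agreement_le {s m : ℕ} (hm : 0 < m) {t : ℝ} (ht : 0 ≤ t) :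
    ∑ f : Fin s → Fin m, ∑ g : Fin s → Fin m, Real.exp (t * agreement f g) ≤
      ((m : ℝ) ^ s) ^ 2 * Real.exp (s / m * (Real.exp t - 1)) := by
  have hm' : (0 : ℝ) < m := Nat.cast_pos.2 hm
  have h₀ : 0 ≤ Real.exp t - 1 := sub_nonneg.2 (Real.one_le_exp ht)
  have h₁ : (m : ℝ) + (Real.exp t - 1) = m * (1 + (Real.exp t - 1) / m) := by field_simp
  have h₂ : (1 + (Real.exp t - 1) / m) ^ s ≤ Real.exp (s / m * (Real.exp t - 1)) := by
    calc (1 + (Real.exp t - 1) / m) ^ s ≤ (Real.exp ((Real.exp t - 1) / m)) ^ s := by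
          gcongr
          rw [add_comm]
          exact Real.add_one_le_exp _
      _ = _ := by
          rw [← Real.exp_nat_mul]
          congr 1
          ring
  simp_rw [sum_exp_agreement]
  rw [Finset.sum_const, nsmul_eq_mul, h₁, mul_pow]
  calc _ = ((m : ℝ) ^ s) ^ 2 * (1 + (Real.exp t - 1) / m) ^ s := by
        simp
        ring
    _ ≤ _ := by gcongr

end Selections

section Risk

variable {d₁ d₂ s₁ s₂ : ℕ} {μ : ℝ} {Δ : (Fin d₁ → Fin d₂ → ℝ) → Bool}

lemma add_Pmeas_le_risk {X : Fin d₁ → Fin d₂ → ℝ} (hX : X ∈ Theta d₁ d₂ s₁ s₂ μ) :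
    (Pmeas d₁ d₂ 0).real {y | Δ y = true} + (Pmeas d₁ d₂ X).real {y | Δ y = false} ≤
      risk d₁ d₂ s₁ s₂ μ Δ := by
  refine add_le_add le_rfl ?_
  have hbdd : BddAbove (Set.range fun X => ⨆ _ : X ∈ Theta d₁ d₂ s₁ s₂ μ,
      (Pmeas d₁ d₂ X {y | Δ y = false}).toReal) := by
    refine ⟨1, ?_⟩
    rintro _ ⟨X, rfl⟩
    exact Real.iSup_le (fun _ => measureReal_le_one) zero_le_one
  refine le_ciSup_of_le hbdd X ?_
  rw [ciSup_pos hX]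
  rfl

lemma risk_le {b : ℝ} (hb : 0 ≤ b)
    (h : ∀ X ∈ Theta d₁ d₂ s₁ s₂ μ, (Pmeas d₁ d₂ X).real {y | Δ y = false} ≤ b) :
    risk d₁ d₂ s₁ s₂ μ Δ ≤ (Pmeas d₁ d₂ 0).real {y | Δ y = true} + b :=
  add_le_add le_rfl (Real.iSup_le (fun X => Real.iSup_le (h X) hb) hb)

/-- The matrix equal to `μ` on `S₁ × S₂` and to zero elsewhere. -/
def blockMatrix (μ : ℝ) (S₁ : Finset (Fin d₁)) (S₂ : Finset (Fin d₂)) : Fin d₁ → Fin d₂ → ℝ :=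
  fun i j => if i ∈ S₁ ∧ j ∈ S₂ then μ else 0

lemma blockMatrix_mem_Theta {S₁ : Finset (Fin d₁)} {S₂ : Finset (Fin d₂)} (h₁ : S₁.card = s₁)
    (h₂ : S₂.card = s₂) : blockMatrix μ S₁ S₂ ∈ Theta d₁ d₂ s₁ s₂ μ :=
  ⟨S₁, S₂, h₁, h₂, fun i j hi hj => by simp [blockMatrix, hi, hj],
    fun i j hij => by simp [blockMatrix, hij]⟩

lemma frobInner_blockMatrix (μ : ℝ) (S₁ T₁ : Finset (Fin d₁)) (S₂ T₂ : Finset (Fin d₂)) :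
    frobInner (blockMatrix μ S₁ S₂) (blockMatrix μ T₁ T₂) =
      μ ^ 2 * (S₂ ∩ T₂).card * (S₁ ∩ T₁).card := by
  have h : ∀ i j, blockMatrix μ S₁ S₂ i j * blockMatrix μ T₁ T₂ i j =
      μ ^ 2 * ((if j ∈ S₂ ∩ T₂ then 1 else 0) * if i ∈ S₁ ∩ T₁ then 1 else 0) := by
    intro i j
    simp only [blockMatrix, Finset.mem_inter]
    by_cases a : i ∈ S₁ <;> by_cases b : j ∈ S₂ <;> by_cases c : i ∈ T₁ <;>
      by_cases d : j ∈ T₂ <;> simp [a, b, c, d, sq]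
  simp only [frobInner, h, ← Finset.mul_sum, ← Finset.sum_mul]
  simp only [Finset.sum_boole, Finset.filter_univ_mem]
  ring

/-- Lower bound for the risk of any test, from a uniform prior on products of selections. -/
lemma le_risk_of_exp_le (hΔ : Measurable Δ) {m₁ m₂ : ℕ} (hm₁ : 0 < m₁) (hm₂ : 0 < m₂)
    (h₁ : s₁ * m₁ ≤ d₁) (h₂ : s₂ * m₂ ≤ d₂) {δ : ℝ} (hδ : 0 < δ) (hμ : μ ^ 2 * s₂ ≤ 1)
    (h : Real.exp (s₂ / m₂ * (Real.exp (2 * (s₁ / m₁) * μ ^ 2) - 1)) ≤ 1 + δ ^ 2) :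
    1 - δ ≤ risk d₁ d₂ s₁ s₂ μ Δ := by
  have : Nonempty (Fin m₁) := ⟨⟨0, hm₁⟩⟩
  have : Nonempty (Fin m₂) := ⟨⟨0, hm₂⟩⟩
  let X : (Fin s₂ → Fin m₂) × (Fin s₁ → Fin m₁) → Fin d₁ → Fin d₂ → ℝ :=
    fun a => blockMatrix μ (selection h₁ a.2) (selection h₂ a.1)
  have hA : MeasurableSet {y | Δ y = false} := hΔ (measurableSet_singleton false)
  have hB : MeasurableSet {y | Δ y = true} := hΔ (measurableSet_singleton true)
  have hrow : ∀ g g' : Fin s₂ → Fin m₂,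
      ∑ f : Fin s₁ → Fin m₁, ∑ f' : Fin s₁ → Fin m₁,
        Real.exp (μ ^ 2 * agreement g g' * agreement f f') ≤
      ((m₁ : ℝ) ^ s₁) ^ 2 * Real.exp (2 * (s₁ / m₁) * μ ^ 2 * agreement g g') := by
    intro g g'
    refine (sum_sum_exp_agreement_le hm₁ (by positivity)).trans ?_
    have hle : μ ^ 2 * agreement g g' ≤ 1 := by
      refine le_trans ?_ hμ
      gcongr
      exact agreement_le g g'
    have h0 : 0 ≤ μ ^ 2 * agreement g g' := by positivity
    have hlin : Real.exp (μ ^ 2 * agreement g g') - 1 ≤ 2 * (μ ^ 2 * agreement g g') := by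
      have := (le_abs_self _).trans (Real.abs_exp_sub_one_le (abs_le.2 ⟨by linarith, hle⟩))
      rwa [abs_of_nonneg h0] at this
    refine mul_le_mul_of_nonneg_left (Real.exp_le_exp.2 ?_) (by positivity)
    calc (s₁ : ℝ) / m₁ * (Real.exp (μ ^ 2 * agreement g g') - 1)
        ≤ s₁ / m₁ * (2 * (μ ^ 2 * agreement g g')) := by gcongr
      _ = _ := by ring
  have hmoment : ∑ a, ∑ b, Real.exp (frobInner (X a) (X b)) ≤
      (1 + δ ^ 2) * (Fintype.card ((Fin s₂ → Fin m₂) × (Fin s₁ → Fin m₁)) : ℝ) ^ 2 := by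
    simp only [X, frobInner_blockMatrix, card_selection_inter, Fintype.sum_prod_type]
    calc ∑ g : Fin s₂ → Fin m₂, ∑ f : Fin s₁ → Fin m₁, ∑ g' : Fin s₂ → Fin m₂,
          ∑ f' : Fin s₁ → Fin m₁, Real.exp (μ ^ 2 * agreement g g' * agreement f f')
        = ∑ g : Fin s₂ → Fin m₂, ∑ g' : Fin s₂ → Fin m₂, ∑ f : Fin s₁ → Fin m₁,
          ∑ f' : Fin s₁ → Fin m₁, Real.exp (μ ^ 2 * agreement g g' * agreement f f') :=
          Finset.sum_congr rfl fun g _ => Finset.sum_comm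
      _ ≤ ∑ g : Fin s₂ → Fin m₂, ∑ g' : Fin s₂ → Fin m₂,
          ((m₁ : ℝ) ^ s₁) ^ 2 * Real.exp (2 * (s₁ / m₁) * μ ^ 2 * agreement g g') := by
          gcongr with g _ g' _
          exact hrow g g'
      _ = ((m₁ : ℝ) ^ s₁) ^ 2 * ∑ g : Fin s₂ → Fin m₂, ∑ g' : Fin s₂ → Fin m₂,
          Real.exp (2 * (s₁ / m₁) * μ ^ 2 * agreement g g') := by
          simp_rw [Finset.mul_sum]
      _ ≤ ((m₁ : ℝ) ^ s₁) ^ 2 * (((m₂ : ℝ) ^ s₂) ^ 2 * (1 + δ ^ 2)) := by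
          gcongr
          refine (sum_sum_exp_agreement_le hm₂ (by positivity)).trans ?_
          gcongr
      _ = _ := by
          simp
          ring
  have hmix := sub_avg_Pmeas_real_le X hA hδ hmoment
  have hle : ∀ a, (Pmeas d₁ d₂ (X a)).real {y | Δ y = false} ≤
      risk d₁ d₂ s₁ s₂ μ Δ - (Pmeas d₁ d₂ 0).real {y | Δ y = true} := fun a =>
    le_sub_iff_add_le'.2 (add_Pmeas_le_risk
      (blockMatrix_mem_Theta (card_selection h₁ _) (card_selection h₂ _)))
  have havg : (∑ a, (Pmeas d₁ d₂ (X a)).real {y | Δ y = false}) /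
      (Fintype.card ((Fin s₂ → Fin m₂) × (Fin s₁ → Fin m₁)) : ℝ) ≤
      risk d₁ d₂ s₁ s₂ μ Δ - (Pmeas d₁ d₂ 0).real {y | Δ y = true} := by
    rw [div_le_iff₀ (Nat.cast_pos.2 Fintype.card_pos), mul_comm]
    refine (Finset.sum_le_sum fun a _ => hle a).trans ?_
    rw [Finset.sum_const, nsmul_eq_mul, Finset.card_univ]
  have hcompl : (Pmeas d₁ d₂ 0).real {y | Δ y = true} +
      (Pmeas d₁ d₂ 0).real {y | Δ y = false} = 1 := by
    have : {y | Δ y = false} = {y | Δ y = true}ᶜ := by ext y; simp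
    rw [this, probReal_add_probReal_compl hB]
  linarith

/-- Risk bound for the test that rejects when some column sum is large. -/
lemma exists_test_risk_le (hd₁ : 0 < d₁) (hd₂ : 0 < d₂) (hs₂ : 0 < s₂)
    (hμ : 4 * (√d₁ * √(Real.log d₂)) ≤ s₁ * μ) :
    ∃ Δ : (Fin d₁ → Fin d₂ → ℝ) → Bool, Measurable Δ ∧
      risk d₁ d₂ s₁ s₂ μ Δ ≤ 2 * Real.exp (-Real.log d₂) := by
  classical
  set L := Real.log d₂
  have hd₁' : (0 : ℝ) < d₁ := Nat.cast_pos.2 hd₁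
  have hd₂' : (0 : ℝ) < d₂ := Nat.cast_pos.2 hd₂
  have hL : 0 ≤ L := Real.log_natCast_nonneg d₂
  set q := √(d₁ : ℝ)
  set r := √L
  have hq : 0 < q := Real.sqrt_pos.2 hd₁'
  have hq2 : q ^ 2 = d₁ := Real.sq_sqrt hd₁'.le
  have hr : 0 ≤ r := Real.sqrt_nonneg L
  have hr2 : r ^ 2 = L := Real.sq_sqrt hL
  have hexp : Real.exp (-L) = 1 / d₂ := by rw [Real.exp_neg, Real.exp_log hd₂', one_div]
  let W : ℝ → Fin d₂ → Fin d₁ → Fin d₂ → ℝ := fun t j _ j' => if j' = j then t else 0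
  have hW : ∀ t j (y : Fin d₁ → Fin d₂ → ℝ), frobInner (W t j) y = t * ∑ i, y i j := by
    intro t j y
    simp [W, frobInner, Finset.mul_sum]
  have hWW : ∀ t j, frobInner (W t j) (W t j) = d₁ * t ^ 2 := by
    intro t j
    rw [hW]
    simp [W]
    ring
  have hnorm : d₁ * (2 * r / q) ^ 2 = 4 * L := by
    rw [← hq2, ← hr2]
    field_simp
    ring
  have hcross : 2 * r / q * (2 * (q * r)) = 4 * L := by
    rw [← hr2]
    field_simp
    ring
  let R : Fin d₂ → Set (Fin d₁ → Fin d₂ → ℝ) := fun j => {y | 2 * (q * r) ≤ ∑ i, y i j}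
  have hR : ∀ j, MeasurableSet (R j) := fun j =>
    measurableSet_le measurable_const (by fun_prop)
  refine ⟨fun y => decide (y ∈ ⋃ j, R j), ?_, ?_⟩
  · exact measurable_to_bool (by
      convert MeasurableSet.iUnion hR using 1
      ext y
      simp)
  have hnull : (Pmeas d₁ d₂ 0).real {y | decide (y ∈ ⋃ j, R j) = true} ≤
      d₂ * Real.exp (-(2 * L)) := by
    have : {y | decide (y ∈ ⋃ j, R j) = true} = ⋃ j, R j := by ext y; simp
    rw [this]
    refine (measureReal_iUnion_fintype_le R).trans ?_
    have hj : ∀ j, (Pmeas d₁ d₂ 0).real (R j) ≤ Real.exp (-(2 * L)) := by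
      intro j
      refine le_trans (measureReal_mono fun y hy => ?_)
        ((Pmeas_real_le_frobInner_le (W (2 * r / q) j) 0 (2 * r / q * (2 * (q * r)))).trans ?_)
      · change _ ≤ frobInner _ y
        rw [hW]
        exact mul_le_mul_of_nonneg_left hy (by positivity)
      · rw [hWW, hW, hnorm, hcross]
        simp
        linarith
    refine (Finset.sum_le_sum fun j _ => hj j).trans ?_
    simp
  have halt : ∀ X ∈ Theta d₁ d₂ s₁ s₂ μ,
      (Pmeas d₁ d₂ X).real {y | decide (y ∈ ⋃ j, R j) = false} ≤ Real.exp (-(2 * L)) := by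
    rintro X ⟨S₁, S₂, hS₁, hS₂, hX, hX0⟩
    obtain ⟨j, hj⟩ : S₂.Nonempty := Finset.card_pos.1 (hS₂ ▸ hs₂)
    have hsum : 4 * (q * r) ≤ ∑ i, X i j := by
      refine hμ.trans ?_
      rw [← Finset.sum_subset (Finset.subset_univ S₁) fun i _ hi =>
        hX0 i j fun hij => hi hij.1, ← hS₁, ← nsmul_eq_mul]
      exact Finset.card_nsmul_le_sum _ _ _ fun i hi => hX i j hi hj
    refine le_trans (measureReal_mono fun y hy => ?_)
      ((Pmeas_real_le_frobInner_le (W (-(2 * r / q)) j) X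
        (-(2 * r / q) * (2 * (q * r)))).trans ?_)
    · have hy' : ∑ i, y i j < 2 * (q * r) := by
        by_contra hcon
        have : y ∈ ⋃ j, R j := Set.mem_iUnion.2 ⟨j, not_lt.1 hcon⟩
        simp only [Set.mem_ofPred_eq, decide_eq_false_iff_not] at hy
        exact hy this
      change _ ≤ frobInner _ y
      rw [hW]
      have : 0 ≤ 2 * r / q := by positivity
      nlinarith
    · rw [hWW, hW, neg_sq, hnorm, neg_mul, neg_mul, hcross]
      have : 2 * r / q * (4 * (q * r)) ≤ 2 * r / q * ∑ i, X i j := by gcongr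
      refine Real.exp_le_exp.2 ?_
      linarith
  refine (risk_le (Real.exp_pos _).le halt).trans ?_
  have h2 : d₂ * Real.exp (-(2 * L)) = Real.exp (-L) := by
    have : Real.exp (-(2 * L)) = Real.exp (-L) * Real.exp (-L) := by
      rw [← Real.exp_add]
      congr 1
      ring
    rw [this, hexp]
    field_simp
  have h3 : Real.exp (-(2 * L)) ≤ Real.exp (-L) := Real.exp_le_exp.2 (by linarith)
  linarith

end Risk

lemma div_natDiv_le {s d : ℕ} (hs : 0 < s) (hsd : s ≤ d) :
    (s : ℝ) / ((d / s : ℕ) : ℝ) ≤ 2 * ((s : ℝ) ^ 2 / d) := by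
  have hm : 0 < d / s := Nat.div_pos hsd hs
  have h₁ : d < s * (d / s + 1) := by
    rw [mul_comm]
    exact Nat.lt_mul_of_div_lt (Nat.lt_succ_self _) hs
  have h₂ : d ≤ 2 * (s * (d / s)) := by nlinarith
  have h₃ : (d : ℝ) ≤ 2 * (s * ((d / s : ℕ) : ℝ)) := by exact_mod_cast h₂
  have hs' : (0 : ℝ) < s := Nat.cast_pos.2 hs
  have hd' : (0 : ℝ) < d := Nat.cast_pos.2 (hs.trans_le hsd)
  have hm' : (0 : ℝ) < ((d / s : ℕ) : ℝ) := Nat.cast_pos.2 hm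
  rw [div_le_iff₀ hm', mul_div_assoc', div_mul_eq_mul_div, le_div_iff₀ hd']
  nlinarith

/-- Regime where the Butucea–Ingster rate is suboptimal (Corollary 4):
(μ*)² ≍ (d₁/s₁²)·log d₂. -/
theorem suboptimal_regime (η α : ℝ) (hη0 : 0 < η) (hη1 : η < 1) (hα : 0 < α) :
    ∃ c₁ c₂ c C : ℝ, 0 < c₁ ∧ 0 < c₂ ∧ 0 < c ∧ 0 < C ∧
      ∀ (d₁ d₂ s₁ s₂ : ℕ), 0 < d₁ → 0 < d₂ →
        1 ≤ s₁ → s₁ ≤ d₁ → 1 ≤ s₂ → s₂ ≤ d₂ →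
        (d₁ : ℝ) * (s₂ : ℝ) * Real.log (d₂ : ℝ) < (s₁ : ℝ) ^ 2 →
        (s₁ : ℝ) ≤ c₁ * (d₁ : ℝ) →
        (s₂ : ℝ) ≤ c₂ * (d₂ : ℝ) →
        Real.exp 1 * Real.log ((d₂ : ℝ) / (s₂ : ℝ)) ≤ (d₁ : ℝ) / (s₁ : ℝ) →
        (s₂ : ℝ) ^ ((2 : ℝ) + α) ≤ (d₂ : ℝ) →
        c * (((d₁ : ℝ) / (s₁ : ℝ) ^ 2) * Real.log (d₂ : ℝ)) ≤
            (muStar η d₁ d₂ s₁ s₂) ^ 2 ∧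
        (muStar η d₁ d₂ s₁ s₂) ^ 2 ≤
          C * (((d₁ : ℝ) / (s₁ : ℝ) ^ 2) * Real.log (d₂ : ℝ)) := by
  set δ := 1 - η with hδ_def
  have hδ : 0 < δ := by linarith
  set β := α / (2 * (2 + α)) with hβ_def
  have hβ : 0 < β := by positivity
  have hβ1 : β ≤ 1 := by
    rw [hβ_def, div_le_one (by positivity)]
    linarith
  have hβ2 : 2 * β * (2 + α) = α := by
    rw [hβ_def]
    field_simp
  set ℓ := Real.log (1 + δ ^ 2)
  have hℓ : 0 < ℓ := Real.log_pos (by nlinarith)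
  set K := max 1 (max (Real.log (4 / η)) (Real.log (2 / ℓ) / β))
  refine ⟨1, Real.exp (-K), β / 4, 16, one_pos, Real.exp_pos _, by positivity, by norm_num, ?_⟩
  intro d₁ d₂ s₁ s₂ hd₁ hd₂ hs₁ hs₁d hs₂ hs₂d hreg _ hc₂ _ hpow
  set L := Real.log d₂
  have hd₁' : (0 : ℝ) < d₁ := Nat.cast_pos.2 hd₁
  have hd₂' : (0 : ℝ) < d₂ := Nat.cast_pos.2 hd₂
  have hs₁' : (0 : ℝ) < s₁ := Nat.cast_pos.2 hs₁
  have hs₂' : (0 : ℝ) < s₂ := Nat.cast_pos.2 hs₂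
  have hexpL : Real.exp L = d₂ := Real.exp_log hd₂'
  have hKL : K ≤ L := by
    rw [← Real.exp_le_exp, hexpL]
    have h : 1 ≤ Real.exp (-K) * d₂ := le_trans (by exact_mod_cast hs₂) hc₂
    rwa [Real.exp_neg, inv_mul_eq_div, one_le_div (Real.exp_pos K)] at h
  have hL1 : 1 ≤ L := (le_max_left _ _).trans hKL
  have hLη : Real.log (4 / η) ≤ L := ((le_max_left _ _).trans (le_max_right _ _)).trans hKL
  have hLℓ : Real.log (2 / ℓ) / β ≤ L := ((le_max_right _ _).trans (le_max_right _ _)).trans hKL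
  have hηL : 2 * Real.exp (-L) < η := by
    rw [Real.log_le_iff_le_exp (by positivity), div_le_iff₀ hη0] at hLη
    rw [Real.exp_neg, ← div_eq_mul_inv, div_lt_iff₀ (Real.exp_pos L)]
    linarith
  have hℓL : 2 * Real.exp (-(β * L)) ≤ ℓ := by
    rw [div_le_iff₀ hβ, Real.log_le_iff_le_exp (by positivity), div_le_iff₀ hℓ] at hLℓ
    rw [Real.exp_neg, ← div_eq_mul_inv, div_le_iff₀ (Real.exp_pos _), mul_comm β L]
    linarith
  set feasible := {μ : ℝ | 0 < μ ∧ ∃ Δ : (Fin d₁ → Fin d₂ → ℝ) → Bool,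
    Measurable Δ ∧ risk d₁ d₂ s₁ s₂ μ Δ < η}
  have hmu : muStar η d₁ d₂ s₁ s₂ = sInf feasible := rfl
  set μ₀ := 4 * (√(d₁ : ℝ) * √L) / s₁ with hμ₀_def
  have hμ₀ : μ₀ ∈ feasible := by
    have hpos : 0 < μ₀ := by positivity
    obtain ⟨Δ, hΔ, hrisk⟩ := exists_test_risk_le (s₁ := s₁) (μ := μ₀) hd₁ hd₂ hs₂
      (by rw [hμ₀_def]; field_simp; rfl)
    exact ⟨hpos, Δ, hΔ, hrisk.trans_lt hηL⟩
  have hμ₀sq : μ₀ ^ 2 = 16 * ((d₁ : ℝ) / (s₁ : ℝ) ^ 2 * L) := by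
    rw [hμ₀_def, div_pow, mul_pow, mul_pow, Real.sq_sqrt hd₁'.le, Real.sq_sqrt (by linarith)]
    ring
  have hbdd : BddBelow feasible := ⟨0, fun μ hμ => hμ.1.le⟩
  have hlower : ∀ μ ∈ feasible, β / 4 * ((d₁ : ℝ) / (s₁ : ℝ) ^ 2 * L) ≤ μ ^ 2 := by
    rintro μ ⟨hμ, Δ, hΔ, hrisk⟩
    by_contra! hcon
    refine hrisk.not_ge ?_
    have hη : η = 1 - δ := by rw [hδ_def]; ring
    rw [hη]
    have hsq : (s₁ : ℝ) ^ 2 / d₁ * μ ^ 2 ≤ β / 4 * L := by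
      calc (s₁ : ℝ) ^ 2 / d₁ * μ ^ 2
          ≤ (s₁ : ℝ) ^ 2 / d₁ * (β / 4 * ((d₁ : ℝ) / (s₁ : ℝ) ^ 2 * L)) := by gcongr
        _ = β / 4 * L := by field_simp
    have hμs : μ ^ 2 * s₂ ≤ 1 := by
      calc μ ^ 2 * s₂ ≤ β / 4 * ((d₁ : ℝ) / (s₁ : ℝ) ^ 2 * L) * s₂ := by gcongr
        _ = β / 4 * (d₁ * s₂ * L / (s₁ : ℝ) ^ 2) := by ring
        _ ≤ 1 / 4 * 1 := by
            gcongr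
            exact (div_le_one (by positivity)).2 hreg.le
        _ ≤ 1 := by norm_num
    refine le_risk_of_exp_le hΔ (Nat.div_pos hs₁d hs₁) (Nat.div_pos hs₂d hs₂)
      (Nat.mul_div_le _ _) (Nat.mul_div_le _ _) hδ hμs ?_
    rw [← Real.le_log_iff_exp_le (by positivity)]
    have hin : 2 * ((s₁ : ℝ) / ((d₁ / s₁ : ℕ) : ℝ)) * μ ^ 2 ≤ β * L := by
      have := div_natDiv_le hs₁ hs₁d
      calc 2 * ((s₁ : ℝ) / ((d₁ / s₁ : ℕ) : ℝ)) * μ ^ 2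
          ≤ 2 * (2 * ((s₁ : ℝ) ^ 2 / d₁)) * μ ^ 2 := by gcongr
        _ = 4 * ((s₁ : ℝ) ^ 2 / d₁ * μ ^ 2) := by ring
        _ ≤ β * L := by linarith
    have hs₂sq : (s₂ : ℝ) ^ 2 / d₂ ≤ Real.exp (-(2 * β * L)) := by
      have hlog : (2 + α) * Real.log s₂ ≤ L := by
        rw [← Real.log_rpow hs₂']
        exact Real.log_le_log (by positivity) hpow
      rw [← hexpL, ← Real.exp_log hs₂', ← Real.exp_nat_mul, ← Real.exp_sub]
      refine Real.exp_le_exp.2 ?_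
      have h2 : (2 + α) * (2 * Real.log s₂ - L + 2 * β * L) ≤ 0 := by
        have : (2 + α) * (2 * β * L) = α * L := by rw [← mul_assoc, mul_comm (2 + α), hβ2]
        nlinarith
      have h3 : 2 * Real.log s₂ - L + 2 * β * L ≤ 0 := by
        by_contra! h
        exact h2.not_gt (by positivity)
      push_cast
      linarith
    have hexp1 : 0 ≤ Real.exp (β * L) - 1 := sub_nonneg.2 (Real.one_le_exp (by positivity))
    have := div_natDiv_le hs₂ hs₂d
    calc (s₂ : ℝ) / ((d₂ / s₂ : ℕ) : ℝ) *
          (Real.exp (2 * ((s₁ : ℝ) / ((d₁ / s₁ : ℕ) : ℝ)) * μ ^ 2) - 1)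
        ≤ (s₂ : ℝ) / ((d₂ / s₂ : ℕ) : ℝ) * (Real.exp (β * L) - 1) := by gcongr
      _ ≤ 2 * ((s₂ : ℝ) ^ 2 / d₂) * (Real.exp (β * L) - 1) := by gcongr
      _ ≤ 2 * Real.exp (-(2 * β * L)) * Real.exp (β * L) := by
          gcongr
          linarith
      _ = 2 * Real.exp (-(β * L)) := by
          rw [mul_assoc, ← Real.exp_add]
          congr 2
          ring
      _ ≤ ℓ := hℓL
  have hrate : 0 ≤ (d₁ : ℝ) / (s₁ : ℝ) ^ 2 * L := by positivity
  have hnonneg : 0 ≤ sInf feasible := Real.sInf_nonneg fun μ hμ => hμ.1.le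
  rw [hmu]
  constructor
  · rw [← Real.sqrt_le_left hnonneg]
    exact le_csInf ⟨μ₀, hμ₀⟩ fun μ hμ => (Real.sqrt_le_left hμ.1.le).2 (hlower μ hμ)
  · rw [← hμ₀sq]
    gcongr
    exact csInf_le hbdd hμ₀
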